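/- Let X be an n×n unitarily invariant random matrix with noncommutative entries over a noncommutative probability space (A,E), let p₁,…,p_l ≥ 1 be integers with k = p₁+⋯+p_l ≤ n, and let γ ∈ S_k be the permutation with cycles (1,…,p₁)(p₁+1,…,p₁+p₂)⋯(p₁+⋯+p_{l−1}+1,…,k). Then k(Tr X^{p₁},…,Tr X^{p_l}) = Σ_{(V,π)} κ_{(V,π)} · n^{#(γπ⁻¹)}, where the sum runs over all partitioned permutations (V,π) of {1,…,k} such that V ∨ C(γ) = 1_k, Tr denotes the unnormalized trace, and #σ denotes the number of cycles of a permutation σ. -/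

import Mathlib

open scoped Classical BigOperators
open Filter

noncomputable section

namespace HOF

instance setoidFinite {α : Type*} [Finite α] : Finite (Setoid α) :=
  Finite.of_injective (fun V : Setoid α => V.r)
    (fun V W h => Setoid.ext fun a b => by rw [show V.r = W.r from h])

instance setoidFintype {α : Type*} [Finite α] : Fintype (Setoid α) := Fintype.ofFinite _

instance matrixMeasurableSpace {n : ℕ} : MeasurableSpace (Matrix (Fin n) (Fin n) ℂ) :=
  MeasurableSpace.pi

variable {A : Type*}

/-- Ordered product of the `a i` over the indices in `S`, in increasing order of indices. -/
def ordProd [Monoid A] {l : ℕ} (a : Fin l → A) (S : Set (Fin l)) : A :=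
  (((List.finRange l).filter (fun i => decide (i ∈ S))).map a).prod

/-- The moment functional `E_V` associated to a set partition `V` (encoded as a `Setoid`):
the product over the blocks of `V` of `E` applied to the ordered product over each block. -/
def momentV {R : Type*} [CommRing R] [Monoid A] {l : ℕ} (E : A → R)
    (V : Setoid (Fin l)) (a : Fin l → A) : R :=
  ∏ᶠ B ∈ Setoid.classes V, E (ordProd a B)

/-- `k` is the family of tensor cumulants associated to the expectation `E`:
for every partition `V`, `∑_{W ≤ V} k_W = E_V`. -/
def IsCumulant {R : Type*} [CommRing R] [Monoid A] (E : A → R)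
    (k : ∀ {l : ℕ}, Setoid (Fin l) → (Fin l → A) → R) : Prop :=
  ∀ (l : ℕ) (V : Setoid (Fin l)) (a : Fin l → A),
    ∑ W ∈ Finset.univ.filter (fun W : Setoid (Fin l) => W ≤ V), k W a = momentV E V a

/-- Number of blocks of a partition. -/
def numBlocks {l : ℕ} (V : Setoid (Fin l)) : ℕ := (Setoid.classes V).ncard

/-- The partition of cycles of a permutation. -/
def cycleSetoid {l : ℕ} (π : Equiv.Perm (Fin l)) : Setoid (Fin l) :=
  ⟨π.SameCycle, ⟨fun x => Equiv.Perm.SameCycle.refl π x, fun h => h.symm, fun h h' => h.trans h'⟩⟩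

/-- Number of cycles of a permutation. -/
def numCycles {l : ℕ} (π : Equiv.Perm (Fin l)) : ℕ := numBlocks (cycleSetoid π)

/-- `π ≤ V` : every cycle of `π` is contained in a block of `V`, i.e. `(V, π)` is a
partitioned permutation. -/
def permLePartition {l : ℕ} (π : Equiv.Perm (Fin l)) (V : Setoid (Fin l)) : Prop :=
  ∀ i, V.r i (π i)

/-- Length `|π| = l - #π` of a permutation. -/
def permLen {l : ℕ} (π : Equiv.Perm (Fin l)) : ℤ := (l : ℤ) - numCycles π

/-- Length `|(V,π)| = |π| + 2(#π - #V)` of a partitioned permutation. -/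
def ppLen {l : ℕ} (V : Setoid (Fin l)) (π : Equiv.Perm (Fin l)) : ℤ :=
  ((l : ℤ) - numCycles π) + 2 * ((numCycles π : ℤ) - numBlocks V)

/-- The order `(V,π) ≤ (W,σ)` on partitioned permutations, i.e.
`(V,π) ⬝ (0, π⁻¹σ) = (W,σ)` (with lengths adding up). -/
def ppLe {l : ℕ} (V : Setoid (Fin l)) (π : Equiv.Perm (Fin l))
    (W : Setoid (Fin l)) (σ : Equiv.Perm (Fin l)) : Prop :=
  V ⊔ cycleSetoid (π⁻¹ * σ) = W ∧ ppLen V π + permLen (π⁻¹ * σ) = ppLen W σ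

/-- `(V,π)` and `(W,τ)` are conjugate by the permutation `σ`. -/
def ppConjBy {l : ℕ} (σ : Equiv.Perm (Fin l)) (V : Setoid (Fin l)) (π : Equiv.Perm (Fin l))
    (W : Setoid (Fin l)) (τ : Equiv.Perm (Fin l)) : Prop :=
  τ = σ * π * σ⁻¹ ∧ ∀ a b, W.r a b ↔ V.r (σ⁻¹ a) (σ⁻¹ b)

/-- `(V,π)` and `(W,τ)` are conjugate partitioned permutations. -/
def ppConj {l : ℕ} (V : Setoid (Fin l)) (π : Equiv.Perm (Fin l))
    (W : Setoid (Fin l)) (τ : Equiv.Perm (Fin l)) : Prop :=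
  ∃ σ : Equiv.Perm (Fin l), ppConjBy σ V π W τ

/-- The `(i,j)` entry of `U X U⁻¹ = U X U*` for a unitary `U` (with complex entries) and a
matrix `X` with noncommutative entries. -/
def conjEntry [Ring A] [Algebra ℂ A] {n : ℕ} (U : Matrix (Fin n) (Fin n) ℂ)
    (X : Matrix (Fin n) (Fin n) A) (i j : Fin n) : A :=
  ∑ a : Fin n, ∑ b : Fin n, (U i a * star (U j b)) • X a b

/-- A random matrix with noncommutative entries is unitarily invariant if for every unitary `U`
the joint distribution (all joint moments under `E`) of the entries of `U X U⁻¹` coincides with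
that of the entries of `X`. -/
def UnitarilyInvariant [Ring A] [Algebra ℂ A] (E : A → ℂ) {n : ℕ}
    (X : Matrix (Fin n) (Fin n) A) : Prop :=
  ∀ U ∈ Matrix.unitaryGroup (Fin n) ℂ, ∀ (m : ℕ) (i j : Fin m → Fin n),
    E (List.ofFn (fun t => conjEntry U X (i t) (j t))).prod
      = E (List.ofFn (fun t => X (i t) (j t))).prod

/-- `κ_{(V,π)} = k_V(X_{1π(1)}, …, X_{mπ(m)})`. -/
def kappa {n : ℕ} (k : ∀ {l : ℕ}, Setoid (Fin l) → (Fin l → A) → ℂ)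
    (X : Matrix (Fin n) (Fin n) A) {m : ℕ} (h : m ≤ n)
    (V : Setoid (Fin m)) (π : Equiv.Perm (Fin m)) : ℂ :=
  k V (fun t => X (Fin.castLE h t) (Fin.castLE h (π t)))

/-- The sequence `n ↦ κ_{(V,π)}(X_n)` (with junk value `0` for `n < m`). -/
def kappaSeq {A : ℕ → Type*} (k : ∀ n, ∀ {l : ℕ}, Setoid (Fin l) → (Fin l → A n) → ℂ)
    (X : ∀ n, Matrix (Fin n) (Fin n) (A n)) {m : ℕ}
    (V : Setoid (Fin m)) (π : Equiv.Perm (Fin m)) (n : ℕ) : ℂ :=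
  if h : m ≤ n then kappa (k n) (X n) h V π else 0

/-- Normalized trace of a matrix with entries in a `ℂ`-algebra. -/
def ncTrace [Ring A] [Algebra ℂ A] {n : ℕ} (X : Matrix (Fin n) (Fin n) A) : A :=
  ((n : ℂ)⁻¹) • Matrix.trace X

/-- Partial sums `p₁ + ⋯ + p_j`. -/
def psum {l : ℕ} (p : Fin l → ℕ) (j : ℕ) : ℕ := ∑ i : Fin l, if (i : ℕ) < j then p i else 0

/-- `γ` is the permutation with the cycles `(1,…,p₁)(p₁+1,…,p₁+p₂)⋯`. -/
def IsCycleType {l k : ℕ} (p : Fin l → ℕ) (γ : Equiv.Perm (Fin k)) : Prop :=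
  psum p l = k ∧
  (∀ (j : ℕ), j < l → ∀ t : Fin k, psum p j ≤ (t : ℕ) → (t : ℕ) + 1 < psum p (j + 1) →
    ((γ t : Fin k) : ℕ) = (t : ℕ) + 1) ∧
  (∀ (j : ℕ), j < l → ∀ t : Fin k, (t : ℕ) + 1 = psum p (j + 1) → ((γ t : Fin k) : ℕ) = psum p j)

/-- The section `Fin (m-1) → Fin m` merging `i` and `i+1` (both are hit by `i`). -/
def mergeEmb (m i : ℕ) (_hi : i + 1 < m) (t : Fin (m - 1)) : Fin m :=
  if (t : ℕ) ≤ i then ⟨t, by have := t.isLt; omega⟩ else ⟨(t : ℕ) + 1, by have := t.isLt; omega⟩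

/-- The partition of `{1,…,m-1}` obtained from a partition of `{1,…,m}` by merging the
elements `i` and `i+1` into a single element. -/
def mergeSetoid {m : ℕ} (W : Setoid (Fin m)) (i : ℕ) (hi : i + 1 < m) : Setoid (Fin (m - 1)) :=
  Setoid.comap (mergeEmb m i hi) W

/-- The tuple `(a₁, …, a_{i-1}, [a_i, a_{i+1}], a_{i+2}, …, a_m)` of length `m-1`. -/
def mergeSeq [Ring A] {m : ℕ} (a : Fin m → A) (i : ℕ) (hi : i + 1 < m)
    (t : Fin (m - 1)) : A :=
  if (t : ℕ) < i then a ⟨t, by have := t.isLt; omega⟩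
  else if (t : ℕ) = i then
    a ⟨i, by omega⟩ * a ⟨i + 1, hi⟩ - a ⟨i + 1, hi⟩ * a ⟨i, by omega⟩
  else a ⟨(t : ℕ) + 1, by have := t.isLt; omega⟩


/-! ### Cumulants as Möbius inverses of moments -/

/-- A function on a finite poset is determined by its sums over lower sets. -/
lemma eq_of_sum_le_eq {α : Type*} [PartialOrder α] [Fintype α] {f g : α → ℂ} (v : α)
    (h : ∀ u ≤ v, ∑ w ∈ Finset.univ.filter (fun w => w ≤ u), f w
      = ∑ w ∈ Finset.univ.filter (fun w => w ≤ u), g w) : f v = g v := by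
  induction v using WellFoundedLT.induction with
  | ind v ih =>
    have hv : v ∈ Finset.univ.filter (fun w => w ≤ v) := by simp
    have h1 := h v le_rfl
    rw [← Finset.add_sum_erase _ _ hv, ← Finset.add_sum_erase _ _ hv] at h1
    have h2 : ∑ w ∈ (Finset.univ.filter (fun w => w ≤ v)).erase v, f w
        = ∑ w ∈ (Finset.univ.filter (fun w => w ≤ v)).erase v, g w := by
      refine Finset.sum_congr rfl fun w hw => ?_
      simp only [Finset.mem_erase, Finset.mem_filter, Finset.mem_univ, true_and] at hw
      exact ih w (lt_of_le_of_ne hw.2 hw.1) fun u hu => h u (hu.trans hw.2)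
    rw [h2] at h1
    exact add_right_cancel h1

lemma momentV_eq_prod_quotient {R : Type*} [CommRing R] [Monoid A] {l : ℕ} (E : A → R)
    (V : Setoid (Fin l)) (a : Fin l → A) :
    momentV E V a = ∏ q : Quotient V, E (ordProd a {x | Quotient.mk V x = q}) := by
  have hr : Setoid.classes V = Set.range (fun q : Quotient V => {x | Quotient.mk V x = q}) := by
    ext s
    constructor
    · rintro ⟨y, rfl⟩
      refine ⟨Quotient.mk V y, ?_⟩
      ext x
      exact Quotient.eq (r := V)
    · rintro ⟨q, rfl⟩
      induction q using Quotient.inductionOn with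
      | h y =>
        refine ⟨y, ?_⟩
        ext x
        exact Quotient.eq (r := V)
  have hinj : Function.Injective (fun q : Quotient V => {x | Quotient.mk V x = q}) := by
    intro q q' h
    induction q using Quotient.inductionOn with
    | h y =>
      have : y ∈ {x | Quotient.mk V x = q'} := by
        have h' : {x | Quotient.mk V x = Quotient.mk V y} = {x | Quotient.mk V x = q'} := h
        rw [← h']
        rfl
      exact this
  rw [momentV, hr, finprod_mem_range hinj, finprod_eq_prod_of_fintype]

lemma list_prod_map_update [Monoid A] {ι : Type*} [DecidableEq ι] (L : List ι) (hL : L.Nodup)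
    (a : ι → A) (t : ι) (ht : t ∈ L) :
    ∃ P Q : A, ∀ x, (L.map (Function.update a t x)).prod = P * x * Q := by
  obtain ⟨L₁, L₂, rfl⟩ := List.append_of_mem ht
  have h1 : t ∉ L₁ := fun h => by
    have := (List.nodup_append.1 hL).2.2 t h t (by simp)
    exact this rfl
  have h2 : t ∉ L₂ := (List.nodup_cons.1 (List.nodup_append.1 hL).2.1).1
  refine ⟨(L₁.map a).prod, (L₂.map a).prod, fun x => ?_⟩
  have e1 : L₁.map (Function.update a t x) = L₁.map a :=
    List.map_congr_left fun s hs => Function.update_of_ne (by rintro rfl; exact h1 hs) _ _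
  have e2 : L₂.map (Function.update a t x) = L₂.map a :=
    List.map_congr_left fun s hs => Function.update_of_ne (by rintro rfl; exact h2 hs) _ _
  simp [e1, e2, mul_assoc]

lemma ordProd_congr [Monoid A] {l : ℕ} {a b : Fin l → A} {S : Set (Fin l)}
    (h : ∀ s ∈ S, a s = b s) : ordProd a S = ordProd b S := by
  unfold ordProd
  congr 1
  refine List.map_congr_left fun s hs => h s ?_
  simpa using hs

lemma momentV_update [Ring A] [Algebra ℂ A] (E : A →ₗ[ℂ] ℂ) {l : ℕ} (V : Setoid (Fin l))
    (a : Fin l → A) (t : Fin l) :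
    ∃ (c : ℂ) (P Q : A), ∀ x, momentV E V (Function.update a t x) = c * E (P * x * Q) := by
  obtain ⟨P, Q, h⟩ := list_prod_map_update
    ((List.finRange l).filter (fun i => decide (i ∈ {x | Quotient.mk V x = Quotient.mk V t})))
    ((List.nodup_finRange l).filter _) a t (by simp)
  refine ⟨∏ q ∈ Finset.univ.erase (Quotient.mk V t), E (ordProd a {x | Quotient.mk V x = q}),
    P, Q, fun x => ?_⟩
  rw [momentV_eq_prod_quotient, ← Finset.mul_prod_erase _ _ (Finset.mem_univ (Quotient.mk V t)),
    mul_comm]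
  congr 1
  · refine Finset.prod_congr rfl fun q hq => ?_
    congr 1
    refine ordProd_congr fun s hs => Function.update_of_ne ?_ _ _
    rintro rfl
    exact (Finset.mem_erase.1 hq).1 hs.symm
  · rw [← h x, ordProd]
    congr!

/-- Each tensor cumulant of a linear expectation is multilinear. -/
lemma exists_multilinearMap_eq_cumulant [Ring A] [Algebra ℂ A] (E : A →ₗ[ℂ] ℂ)
    {k : ∀ {l : ℕ}, Setoid (Fin l) → (Fin l → A) → ℂ} (hk : IsCumulant (⇑E) @k)
    {l : ℕ} (V : Setoid (Fin l)) :
    ∃ M : MultilinearMap ℂ (fun _ : Fin l => A) ℂ, ∀ a, M a = k V a := by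
  refine ⟨MultilinearMap.mk' (k V) ?_ ?_, fun a => rfl⟩
  · intro a t x y
    refine eq_of_sum_le_eq (f := fun W => k W (Function.update a t (x + y)))
      (g := fun W => k W (Function.update a t x) + k W (Function.update a t y)) V fun u _ => ?_
    obtain ⟨c, P, Q, h⟩ := momentV_update E u a t
    rw [Finset.sum_add_distrib, hk, hk, hk, h, h, h, mul_add, add_mul, map_add, mul_add]
  · intro a t c x
    refine eq_of_sum_le_eq (f := fun W => k W (Function.update a t (c • x)))
      (g := fun W => c • k W (Function.update a t x)) V fun u _ => ?_
    obtain ⟨d, P, Q, h⟩ := momentV_update E u a t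
    rw [← Finset.smul_sum, hk, hk, h, h, mul_smul_comm, smul_mul_assoc, map_smul, smul_eq_mul,
      smul_eq_mul]
    ring

/-! ### Block-wise unitary invariance of the cumulants -/

lemma map_ordProd_conjEntry [Ring A] [Algebra ℂ A] (E : A → ℂ) {n : ℕ}
    {X : Matrix (Fin n) (Fin n) A} (hX : UnitarilyInvariant E X)
    {U : Matrix (Fin n) (Fin n) ℂ} (hU : U ∈ Matrix.unitaryGroup (Fin n) ℂ)
    {m : ℕ} (i j : Fin m → Fin n) (S : Set (Fin m)) :
    E (ordProd (fun t => conjEntry U X (i t) (j t)) S)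
      = E (ordProd (fun t => X (i t) (j t)) S) := by
  unfold ordProd
  set L := (List.finRange m).filter (fun i => decide (i ∈ S))
  have h := hX U hU L.length (fun s => i (L.get s)) (fun s => j (L.get s))
  have e : ∀ f : Fin m → A, L.map f = List.ofFn (fun s : Fin L.length => f (L.get s)) := by
    intro f
    conv_lhs => rw [← List.ofFn_get L, List.map_ofFn]
    rfl
  rw [e, e]
  exact h

lemma momentV_conjEntry [Ring A] [Algebra ℂ A] (E : A → ℂ) {n : ℕ}
    {X : Matrix (Fin n) (Fin n) A} (hX : UnitarilyInvariant E X)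
    {m : ℕ} (V : Setoid (Fin m)) (U : Fin m → Matrix (Fin n) (Fin n) ℂ)
    (hU : ∀ t, U t ∈ Matrix.unitaryGroup (Fin n) ℂ) (hUV : ∀ s t, V s t → U s = U t)
    (i j : Fin m → Fin n) :
    momentV E V (fun t => conjEntry (U t) X (i t) (j t))
      = momentV E V (fun t => X (i t) (j t)) := by
  rw [momentV_eq_prod_quotient, momentV_eq_prod_quotient]
  refine Finset.prod_congr rfl fun q _ => ?_
  induction q using Quotient.inductionOn with
  | h y =>
    rw [← map_ordProd_conjEntry E hX (hU y)]
    congr 1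
    refine ordProd_congr fun s hs => ?_
    rw [hUV s y (Quotient.eq.1 hs)]

/-- Invariance of a tensor `T` under families of unitaries that are constant on the blocks of
the partition `V`. -/
def BlockInvariant {n m : ℕ} (V : Setoid (Fin m))
    (T : (Fin m → Fin n) → (Fin m → Fin n) → ℂ) : Prop :=
  ∀ U : Fin m → Matrix (Fin n) (Fin n) ℂ, (∀ t, U t ∈ Matrix.unitaryGroup (Fin n) ℂ) →
    (∀ s t, V s t → U s = U t) → ∀ i j : Fin m → Fin n,
      ∑ a : Fin m → Fin n, ∑ b : Fin m → Fin n,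
        (∏ t, U t (i t) (a t)) * star (∏ t, U t (j t) (b t)) * T a b = T i j

lemma blockInvariant_cumulant [Ring A] [Algebra ℂ A] (E : A →ₗ[ℂ] ℂ)
    {k : ∀ {l : ℕ}, Setoid (Fin l) → (Fin l → A) → ℂ} (hk : IsCumulant (⇑E) @k)
    {n : ℕ} {X : Matrix (Fin n) (Fin n) A} (hX : UnitarilyInvariant (⇑E) X)
    {m : ℕ} (V : Setoid (Fin m)) :
    BlockInvariant V (fun i j : Fin m → Fin n => k V (fun t => X (i t) (j t))) := by
  intro U hU hUV i j
  have h1 : k V (fun t => conjEntry (U t) X (i t) (j t)) = k V (fun t => X (i t) (j t)) := by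
    refine eq_of_sum_le_eq (f := fun W => k W (fun t => conjEntry (U t) X (i t) (j t)))
      (g := fun W => k W (fun t => X (i t) (j t))) V fun u hu => ?_
    rw [hk, hk]
    exact momentV_conjEntry E hX u U hU (fun s t h => hUV s t (hu h)) i j
  obtain ⟨M, hM⟩ := exists_multilinearMap_eq_cumulant E hk V
  have h2 : ∀ t, conjEntry (U t) X (i t) (j t)
      = ∑ c : Fin n × Fin n, (U t (i t) c.1 * star (U t (j t) c.2)) • X c.1 c.2 := by
    intro t
    rw [conjEntry, Fintype.sum_prod_type]
  simp only [← hM] at h1 ⊢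
  rw [← h1]
  simp only [h2]
  rw [MultilinearMap.map_sum]
  simp only [MultilinearMap.map_smul_univ, smul_eq_mul]
  rw [← Fintype.sum_prod_type'
    (f := fun a b : Fin m → Fin n => (∏ t, U t (i t) (a t)) * star (∏ t, U t (j t) (b t)) *
      M (fun t => X (a t) (b t)))]
  refine (Fintype.sum_equiv (Equiv.arrowProdEquivProdArrow (Fin m) (fun _ => Fin n)
    (fun _ => Fin n)) _ _ fun r => ?_).symm
  simp [Finset.prod_mul_distrib, Equiv.arrowProdEquivProdArrow]

/-! ### Block-invariant tensors are spanned by permutations -/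

section BlockInvariant

variable {n m : ℕ} {V : Setoid (Fin m)}

lemma BlockInvariant.sub {S T : (Fin m → Fin n) → (Fin m → Fin n) → ℂ}
    (hS : BlockInvariant V S) (hT : BlockInvariant V T) :
    BlockInvariant V (fun i j => S i j - T i j) := by
  intro U hU hUV i j
  simp only [mul_sub, Finset.sum_sub_distrib, hS U hU hUV, hT U hU hUV]

lemma BlockInvariant.mul_const {S : (Fin m → Fin n) → (Fin m → Fin n) → ℂ}
    (hS : BlockInvariant V S) (c : ℂ) :
    BlockInvariant V (fun i j => S i j * c) := by
  intro U hU hUV i j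
  simp only [← mul_assoc, ← Finset.sum_mul, hS U hU hUV]

lemma BlockInvariant.sum {ι : Type*} (s : Finset ι)
    {S : ι → (Fin m → Fin n) → (Fin m → Fin n) → ℂ} (hS : ∀ x ∈ s, BlockInvariant V (S x)) :
    BlockInvariant V (fun i j => ∑ x ∈ s, S x i j) := by
  intro U hU hUV i j
  simp only [Finset.mul_sum]
  rw [← Finset.sum_congr rfl fun x hx => hS x hx U hU hUV i j, Finset.sum_comm]
  simp only [Finset.sum_comm (s := s)]
  rw [Finset.sum_comm]

lemma blockInvariant_perm {π : Equiv.Perm (Fin m)} (hπ : permLePartition π V) :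
    BlockInvariant V (fun i j : Fin m → Fin n => if j = i ∘ π then (1 : ℂ) else 0) := by
  intro U hU hUV i j
  simp only [mul_ite, mul_one, mul_zero, Finset.sum_ite_eq', Finset.mem_univ, if_true]
  have h1 : ∀ a : Fin m → Fin n, star (∏ t, U t (j t) ((a ∘ π) t))
      = ∏ t, star (U t (j (π.symm t)) (a t)) := by
    intro a
    rw [star_prod]
    refine Fintype.prod_equiv π _ _ fun t => ?_
    rw [hUV t (π t) (hπ t)]
    simp
  simp only [h1, ← Finset.prod_mul_distrib]
  rw [← Fintype.prod_sum (fun t c => U t (i t) c * star (U t (j (π.symm t)) c))]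
  have h2 : ∀ t, ∑ c, U t (i t) c * star (U t (j (π.symm t)) c)
      = if i t = j (π.symm t) then 1 else 0 := by
    intro t
    have := congrFun (congrFun (Matrix.mem_unitaryGroup_iff.1 (hU t)) (i t)) (j (π.symm t))
    rw [Matrix.one_apply] at this
    rw [← this]
    rfl
  simp only [h2, Finset.prod_ite_zero, Finset.prod_const_one, Finset.mem_univ, true_implies]
  congr 1
  rw [eq_iff_iff, funext_iff]
  constructor
  · intro h t
    simpa using (h (π t)).symm
  · intro h t
    simpa using (h (π.symm t)).symm

lemma sum_prod_erase_one_mul (i : Fin m → Fin n) (t : Fin m) (F : (Fin m → Fin n) → ℂ) :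
    ∑ a : Fin m → Fin n, (∏ s ∈ Finset.univ.erase t, (1 : Matrix (Fin n) (Fin n) ℂ) (i s) (a s))
      * F a = ∑ c, F (Function.update i t c) := by
  simp only [Matrix.one_apply, Finset.prod_ite_zero, Finset.prod_const_one, ite_mul, one_mul,
    zero_mul]
  rw [← Finset.sum_filter]
  symm
  refine Finset.sum_bij (fun c _ => Function.update i t c) ?_ ?_ ?_ ?_
  · intro c _
    simp only [Finset.mem_filter, Finset.mem_univ, true_and, Finset.mem_erase, and_true]
    intro s hs
    rw [Function.update_of_ne hs]
  · intro c _ d _ h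
    simpa using congrFun h t
  · intro a ha
    simp only [Finset.mem_filter, Finset.mem_univ, true_and, Finset.mem_erase, and_true] at ha
    refine ⟨a t, Finset.mem_univ _, ?_⟩
    ext s
    by_cases hs : s = t
    · subst hs
      simp
    · rw [Function.update_of_ne hs, ha s hs]
  · intro c _
    rfl

lemma sum_deriv_prod_mul (i : Fin m → Fin n) (P : Matrix (Fin n) (Fin n) ℂ) (S : Fin m → Prop)
    (F : (Fin m → Fin n) → ℂ) :
    ∑ a : Fin m → Fin n, (∑ t, (∏ s ∈ Finset.univ.erase t,
      (1 : Matrix (Fin n) (Fin n) ℂ) (i s) (a s)) * (if S t then P (i t) (a t) else 0)) * F a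
      = ∑ t, if S t then ∑ c, P (i t) c * F (Function.update i t c) else 0 := by
  simp only [Finset.sum_mul]
  rw [Finset.sum_comm]
  refine Finset.sum_congr rfl fun t _ => ?_
  simp only [mul_assoc]
  rw [sum_prod_erase_one_mul i t (fun a => (if S t then P (i t) (a t) else 0) * F a)]
  split_ifs <;> simp

/-- The infinitesimal form of the invariance, for the generator `P`. -/
def InfInvariant (V : Setoid (Fin m)) (T : (Fin m → Fin n) → (Fin m → Fin n) → ℂ)
    (P : Matrix (Fin n) (Fin n) ℂ) : Prop :=
  ∀ (r : Fin m) (i j : Fin m → Fin n),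
    (∑ t, if V r t then ∑ c, P (i t) c * T (Function.update i t c) j else 0)
      = ∑ t, if V r t then ∑ c, P c (j t) * T i (Function.update j t c) else 0

lemma one_add_smul_mem_unitaryGroup {P : Matrix (Fin n) (Fin n) ℂ} (hP : P.IsHermitian)
    (hPP : P * P = P) {z : ℂ} (hz : z * star z = 1) :
    1 + (z - 1) • P ∈ Matrix.unitaryGroup (Fin n) ℂ := by
  rw [Matrix.mem_unitaryGroup_iff, Matrix.star_eq_conjTranspose, Matrix.conjTranspose_add,
    Matrix.conjTranspose_one, Matrix.conjTranspose_smul, hP.eq, add_mul, mul_add, one_mul, mul_add,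
    mul_one, smul_mul_smul_comm, hPP, one_mul, add_assoc, ← add_smul, ← add_smul]
  have : star (z - 1) + ((z - 1) + (z - 1) * star (z - 1)) = 0 := by
    rw [star_sub, star_one]
    linear_combination hz
  rw [this, zero_smul, add_zero]

lemma BlockInvariant.infInvariant_of_projection {T : (Fin m → Fin n) → (Fin m → Fin n) → ℂ}
    (hT : BlockInvariant V T) {P : Matrix (Fin n) (Fin n) ℂ} (hP : P.IsHermitian)
    (hPP : P * P = P) : InfInvariant V T P := by
  intro r i j
  set u : ℝ → Fin m → Matrix (Fin n) (Fin n) ℂ := fun θ t =>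
    if V r t then 1 + (Complex.exp (θ * Complex.I) - 1) • P else 1 with hu
  have hcst : ∀ θ : ℝ, ∑ a : Fin m → Fin n, ∑ b : Fin m → Fin n,
      (∏ t, u θ t (i t) (a t)) * star (∏ t, u θ t (j t) (b t)) * T a b = T i j := by
    intro θ
    refine hT (u θ) (fun t => ?_) (fun s t hst => ?_) i j
    · simp only [hu]
      split_ifs
      · refine one_add_smul_mem_unitaryGroup hP hPP ?_
        rw [Complex.star_def, ← Complex.exp_conj, ← Complex.exp_add]
        simp
      · exact one_mem _
    · have : V r s ↔ V r t := ⟨fun h => V.trans h hst, fun h => V.trans h (V.symm hst)⟩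
      simp only [hu, this]
  have hu0 : ∀ t, u 0 t = 1 := by
    intro t
    simp [hu]
  set D : (Fin m → Fin n) → (Fin m → Fin n) → ℂ := fun x a =>
    ∑ t, (∏ s ∈ Finset.univ.erase t, (1 : Matrix (Fin n) (Fin n) ℂ) (x s) (a s)) *
      (if V r t then (Complex.I • P) (x t) (a t) else 0) with hD
  have hder1 : ∀ (t : Fin m) (x y : Fin n),
      HasDerivAt (fun θ => u θ t x y) (if V r t then (Complex.I • P) x y else 0) 0 := by
    intro t x y
    simp only [hu]
    split_ifs
    · have h1 : HasDerivAt (fun θ : ℝ => Complex.exp (θ * Complex.I)) Complex.I 0 := by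
        have h2 : HasDerivAt (fun θ : ℝ => (θ : ℂ) * Complex.I) Complex.I 0 := by
          simpa using (Complex.ofRealCLM.hasDerivAt (x := (0 : ℝ))).mul_const Complex.I
        simpa using h2.cexp
      have h3 := ((h1.sub_const 1).mul_const (P x y)).const_add ((1 : Matrix _ _ ℂ) x y)
      exact h3
    · exact hasDerivAt_const _ _
  have hder2 : ∀ x a : Fin m → Fin n,
      HasDerivAt (fun θ => ∏ t, u θ t (x t) (a t)) (D x a) 0 := by
    intro x a
    have := HasDerivAt.fun_finsetProd (u := Finset.univ) (x := (0 : ℝ))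
      (f := fun t θ => u θ t (x t) (a t)) (fun t _ => hder1 t (x t) (a t))
    simpa [hu0, hD] using this
  have hder3 : HasDerivAt (fun θ : ℝ => ∑ a : Fin m → Fin n, ∑ b : Fin m → Fin n,
      (∏ t, u θ t (i t) (a t)) * star (∏ t, u θ t (j t) (b t)) * T a b)
      (∑ a : Fin m → Fin n, ∑ b : Fin m → Fin n,
        (D i a * star (∏ t, u 0 t (j t) (b t)) +
          (∏ t, u 0 t (i t) (a t)) * star (D j b)) * T a b) 0 :=
    HasDerivAt.fun_sum fun a _ => HasDerivAt.fun_sum fun b _ =>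
      (((hder2 i a).fun_mul (hder2 j b).star).mul_const _)
  have hz : (∑ a : Fin m → Fin n, ∑ b : Fin m → Fin n,
        (D i a * star (∏ t, u 0 t (j t) (b t)) +
          (∏ t, u 0 t (i t) (a t)) * star (D j b)) * T a b) = 0 := by
    simp only [hcst] at hder3
    exact hder3.unique (hasDerivAt_const _ _)
  have hone : ∀ x a : Fin m → Fin n, ∏ t, (1 : Matrix (Fin n) (Fin n) ℂ) (x t) (a t)
      = if x = a then 1 else 0 := by
    intro x a
    simp only [Matrix.one_apply, Finset.prod_ite_zero, Finset.prod_const_one, Finset.mem_univ,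
      true_implies, funext_iff]
  simp only [hu0, hone, add_mul, Finset.sum_add_distrib, apply_ite star, star_one, star_zero,
    mul_ite, ite_mul, mul_one, one_mul, mul_zero, zero_mul] at hz
  have e1 : ∑ a : Fin m → Fin n, ∑ b : Fin m → Fin n, (if j = b then D i a * T a b else 0)
      = Complex.I * ∑ t, if V r t then ∑ c, P (i t) c * T (Function.update i t c) j else 0 := by
    simp only [Finset.sum_ite_eq, Finset.mem_univ, if_true]
    rw [sum_deriv_prod_mul i (Complex.I • P) (fun t => V r t) (fun a => T a j), Finset.mul_sum]
    simp only [mul_ite, mul_zero, Finset.mul_sum, Matrix.smul_apply, smul_eq_mul, mul_assoc]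
  have e2 : ∑ a : Fin m → Fin n, ∑ b : Fin m → Fin n, (if i = a then star (D j b) * T a b else 0)
      = -Complex.I * ∑ t, if V r t then ∑ c, P c (j t) * T i (Function.update j t c) else 0 := by
    rw [Finset.sum_comm]
    simp only [Finset.sum_ite_eq, Finset.mem_univ, if_true]
    have h := congrArg star
      (sum_deriv_prod_mul j (Complex.I • P) (fun t => V r t) (fun b => star (T i b)))
    have hPc : ∀ x y, star (P x y) = P y x := fun x y => hP.apply y x
    simp only [star_sum, star_mul', star_star, apply_ite star, star_zero, Matrix.smul_apply,
      smul_eq_mul, hPc] at h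
    simp only [hD, star_sum, star_mul', apply_ite star, star_zero, Matrix.smul_apply,
      smul_eq_mul, hPc]
    rw [h, Finset.mul_sum]
    refine Finset.sum_congr rfl fun t _ => ?_
    rw [mul_ite, mul_zero, Finset.mul_sum]
    simp [mul_assoc]
  rw [e1, e2] at hz
  have := mul_left_cancel₀ Complex.I_ne_zero
    ((eq_neg_of_add_eq_zero_left hz).trans (by rw [neg_mul, neg_neg]))
  exact this

lemma InfInvariant.add {T : (Fin m → Fin n) → (Fin m → Fin n) → ℂ}
    {P Q : Matrix (Fin n) (Fin n) ℂ} (hP : InfInvariant V T P) (hQ : InfInvariant V T Q) :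
    InfInvariant V T (P + Q) := by
  intro r i j
  have e : ∀ (p : Prop) (x y : ℂ), (if p then x + y else 0)
      = (if p then x else 0) + (if p then y else 0) := by
    intro p x y
    split_ifs <;> simp
  simp only [Matrix.add_apply, add_mul, Finset.sum_add_distrib, e, hP r i j, hQ r i j]

lemma InfInvariant.smul {T : (Fin m → Fin n) → (Fin m → Fin n) → ℂ}
    {P : Matrix (Fin n) (Fin n) ℂ} (hP : InfInvariant V T P) (c : ℂ) :
    InfInvariant V T (c • P) := by
  intro r i j
  have e : ∀ (p : Prop) (x : ℂ), (if p then c * x else 0) = c * (if p then x else 0) := by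
    intro p x
    split_ifs <;> simp
  simp only [Matrix.smul_apply, smul_eq_mul, mul_assoc, ← Finset.mul_sum, e, hP r i j]

lemma BlockInvariant.infInvariant_single {T : (Fin m → Fin n) → (Fin m → Fin n) → ℂ}
    (hT : BlockInvariant V T) (a b : Fin n) :
    InfInvariant V T (Matrix.single a b (1 : ℂ)) := by
  have hd : ∀ a, InfInvariant V T (Matrix.single a a (1 : ℂ)) := fun a =>
    hT.infInvariant_of_projection (by simp [Matrix.IsHermitian, Matrix.conjTranspose_single])
      (by simp)
  by_cases hab : a = b
  · exact hab ▸ hd a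
  have hba : b ≠ a := Ne.symm hab
  have hw : ∀ w : ℂ, star w * w = 1 → InfInvariant V T ((1 / 2 : ℂ) • (Matrix.single a a (1 : ℂ)
      + Matrix.single b b 1 + Matrix.single a b (star w) + Matrix.single b a w)) := by
    intro w hw
    have hw' : w * star w = 1 := by rw [mul_comm, hw]
    refine hT.infInvariant_of_projection ?_ ?_
    · simp only [Matrix.IsHermitian, Matrix.conjTranspose_smul, Matrix.conjTranspose_add,
        Matrix.conjTranspose_single, star_one, star_star]
      congr 1
      · simp
      · abel
    · rw [smul_mul_smul_comm]
      simp only [mul_add, add_mul, Matrix.single_mul_single_same,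
        Matrix.single_mul_single_of_ne _ _ _ _ hab, Matrix.single_mul_single_of_ne _ _ _ _ hba,
        mul_one, one_mul, hw, hw', add_zero, zero_add]
      module
  have h1 := hw 1 (by simp)
  have h2 := hw Complex.I (by simp)
  have e : Matrix.single a b (1 : ℂ) = (1 : ℂ) • ((1 / 2 : ℂ) • (Matrix.single a a (1 : ℂ)
      + Matrix.single b b 1 + Matrix.single a b (star 1) + Matrix.single b a 1))
      + Complex.I • ((1 / 2 : ℂ) • (Matrix.single a a (1 : ℂ)
      + Matrix.single b b 1 + Matrix.single a b (star Complex.I) + Matrix.single b a Complex.I))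
      + (-(1 + Complex.I) / 2) • Matrix.single a a (1 : ℂ)
      + (-(1 + Complex.I) / 2) • Matrix.single b b (1 : ℂ) := by
    have hs : ∀ (x y : Fin n) (z : ℂ), Matrix.single x y z = z • Matrix.single x y (1 : ℂ) := by
      simp
    rw [hs a b (star 1), hs a b (star Complex.I), hs b a Complex.I]
    ext x y
    simp only [Matrix.add_apply, Matrix.smul_apply, smul_eq_mul, star_one, Complex.star_def,
      Complex.conj_I]
    linear_combination (1 / 2 * Matrix.single a b (1 : ℂ) x y
      - 1 / 2 * Matrix.single b a (1 : ℂ) x y) * Complex.I_mul_I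
  rw [e]
  exact (((h1.smul 1).add (h2.smul _)).add ((hd a).smul _)).add ((hd b).smul _)

lemma BlockInvariant.exchange {T : (Fin m → Fin n) → (Fin m → Fin n) → ℂ}
    (hT : BlockInvariant V T) (r : Fin m) (i j : Fin m → Fin n) (a b : Fin n) :
    (∑ t, if V r t ∧ i t = a then T (Function.update i t b) j else 0)
      = ∑ t, if V r t ∧ j t = b then T i (Function.update j t a) else 0 := by
  have h := hT.infInvariant_single a b r i j
  simpa [Matrix.single_apply, ite_and, Finset.sum_ite_eq, eq_comm] using h

lemma BlockInvariant.card_eq {T : (Fin m → Fin n) → (Fin m → Fin n) → ℂ}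
    (hT : BlockInvariant V T) {i j : Fin m → Fin n} (hij : T i j ≠ 0) (r : Fin m) (a : Fin n) :
    (Finset.univ.filter (fun t => V r t ∧ i t = a)).card
      = (Finset.univ.filter (fun t => V r t ∧ j t = a)).card := by
  have h := hT.exchange r i j a a
  have e1 : ∀ t, (if V r t ∧ i t = a then T (Function.update i t a) j else 0)
      = if V r t ∧ i t = a then T i j else 0 := by
    intro t
    split_ifs with ht
    · rw [← ht.2, Function.update_eq_self]
    · rfl
  have e2 : ∀ t, (if V r t ∧ j t = a then T i (Function.update j t a) else 0)
      = if V r t ∧ j t = a then T i j else 0 := by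
    intro t
    split_ifs with ht
    · rw [← ht.2, Function.update_eq_self]
    · rfl
  simp only [e1, e2, ← Finset.sum_filter, Finset.sum_const, nsmul_eq_mul] at h
  exact_mod_cast mul_right_cancel₀ hij h

lemma BlockInvariant.comp_perm {T : (Fin m → Fin n) → (Fin m → Fin n) → ℂ}
    (hT : BlockInvariant V T) (σ : Equiv.Perm (Fin n)) (i j : Fin m → Fin n) :
    T (σ ∘ i) (σ ∘ j) = T i j := by
  set U : Matrix (Fin n) (Fin n) ℂ := Matrix.of fun x y => if σ x = y then 1 else 0 with hU
  have hmem : U ∈ Matrix.unitaryGroup (Fin n) ℂ := by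
    rw [Matrix.mem_unitaryGroup_iff]
    ext x y
    simp [hU, Matrix.mul_apply, Matrix.star_apply, Matrix.one_apply, apply_ite, eq_comm]
  have hp : ∀ x a : Fin m → Fin n, ∏ t, U (x t) (a t) = if σ ∘ x = a then 1 else 0 := by
    intro x a
    simp only [hU, Matrix.of_apply, Finset.prod_ite_zero, Finset.prod_const_one, Finset.mem_univ,
      true_implies, funext_iff, Function.comp_apply]
  have h := hT (fun _ => U) (fun _ => hmem) (fun _ _ _ => rfl) i j
  rw [← h]
  simp only [hp]
  simp [apply_ite]

/-- A block-invariant tensor which vanishes at all permutations below `V` is zero. -/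
lemma BlockInvariant.eq_zero {T : (Fin m → Fin n) → (Fin m → Fin n) → ℂ}
    (hT : BlockInvariant V T) (hmn : m ≤ n)
    (h0 : ∀ π : Equiv.Perm (Fin m), permLePartition π V →
      T (Fin.castLE hmn) (Fin.castLE hmn ∘ π) = 0) (i j : Fin m → Fin n) : T i j = 0 := by
  have hinj := Fin.castLE_injective hmn
  have hbase : ∀ j, T (Fin.castLE hmn) j = 0 := by
    intro j
    by_contra hj
    have hex : ∀ t, ∃ s, V t s ∧ j s = Fin.castLE hmn t := by
      intro t
      have hc := hT.card_eq hj t (Fin.castLE hmn t)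
      have hpos : 0 < (Finset.univ.filter
          (fun s => V t s ∧ Fin.castLE hmn s = Fin.castLE hmn t)).card :=
        Finset.card_pos.2 ⟨t, by simp⟩
      rw [hc] at hpos
      obtain ⟨s, hs⟩ := Finset.card_pos.1 hpos
      exact ⟨s, by simpa using hs⟩
    choose ρ hρV hρ using hex
    have hρi : Function.Injective ρ := fun s t hst => hinj (by rw [← hρ s, ← hρ t, hst])
    set σ : Equiv.Perm (Fin m) := Equiv.ofBijective ρ (Finite.injective_iff_bijective.1 hρi)
    have hσ : ∀ t, σ t = ρ t := fun t => rfl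
    refine hj ?_
    have hjσ : j = Fin.castLE hmn ∘ σ.symm := by
      ext t
      rw [Function.comp_apply, ← hρ, ← hσ, Equiv.apply_symm_apply]
    rw [hjσ]
    refine h0 σ.symm fun t => ?_
    have := hρV (σ.symm t)
    rw [← hσ, Equiv.apply_symm_apply] at this
    exact V.symm this
  have hinjective : ∀ i j, Function.Injective i → T i j = 0 := by
    intro i j hi
    obtain ⟨σ, hσ⟩ : ∃ σ : Equiv.Perm (Fin n), ∀ t, σ (Fin.castLE hmn t) = i t := by
      exact Equiv.Perm.exists_extending_pair _ _ hinj hi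
    have h := hT.comp_perm σ (Fin.castLE hmn) (σ.symm ∘ j)
    rw [hbase] at h
    rw [← h]
    congr 1
    · ext t
      simp [hσ]
    · ext t
      simp
  induction hN : n - (Finset.univ.image i).card using Nat.strong_induction_on generalizing i j with
  | _ N ih =>
    by_cases hi : Function.Injective i
    · exact hinjective i j hi
    obtain ⟨s, t, hst, hne⟩ := Function.not_injective_iff.1 hi
    have hlt : (Finset.univ.image i).card < n := by
      refine lt_of_lt_of_le (lt_of_le_of_ne Finset.card_image_le fun h => hi ?_) ?_
      · simpa using Finset.card_image_iff.1 h
      · simpa using hmn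
    obtain ⟨d, hd⟩ : ∃ d, d ∉ Finset.univ.image i := by
      by_contra hall
      push Not at hall
      rw [Finset.eq_univ_iff_forall.2 hall] at hlt
      simp at hlt
    have hd' : ∀ x, i x ≠ d := fun x hx => hd (by simp [← hx])
    have hzero : ∀ j', T (Function.update i t d) j' = 0 := by
      intro j'
      refine ih _ ?_ (Function.update i t d) j' rfl
      have hsub : insert d (Finset.univ.image i) ⊆ Finset.univ.image (Function.update i t d) := by
        intro x hx
        rw [Finset.mem_insert] at hx
        rcases hx with rfl | hx
        · exact Finset.mem_image.2 ⟨t, by simp⟩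
        · obtain ⟨y, -, rfl⟩ := Finset.mem_image.1 hx
          by_cases hy : y = t
          · exact Finset.mem_image.2 ⟨s, by simp [Function.update_of_ne hne, hy, hst]⟩
          · exact Finset.mem_image.2 ⟨y, by simp [Function.update_of_ne hy]⟩
      have := Finset.card_le_card hsub
      rw [Finset.card_insert_of_notMem hd] at this
      omega
    have hex := hT.exchange t (Function.update i t d) j d (i t)
    simp only [hzero, ite_self, Finset.sum_const_zero] at hex
    rw [Finset.sum_eq_single t] at hex
    · simpa using hex
    · intro x _ hx
      rw [if_neg]
      rintro ⟨-, h⟩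
      rw [Function.update_of_ne hx] at h
      exact hd' x h
    · simp

/-- Block-invariant tensors are linear combinations of permutation tensors. -/
lemma BlockInvariant.eq_sum_perm {T : (Fin m → Fin n) → (Fin m → Fin n) → ℂ}
    (hT : BlockInvariant V T) (hmn : m ≤ n) (i j : Fin m → Fin n) :
    T i j = ∑ π ∈ Finset.univ.filter (fun π : Equiv.Perm (Fin m) => permLePartition π V),
      (if j = i ∘ π then (1 : ℂ) else 0) * T (Fin.castLE hmn) (Fin.castLE hmn ∘ π) := by
  refine sub_eq_zero.1 ((hT.sub (BlockInvariant.sum _ fun π hπ =>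
    (blockInvariant_perm (n := n) (π := π) (Finset.mem_filter.1 hπ).2).mul_const
      (T (Fin.castLE hmn) (Fin.castLE hmn ∘ π)))).eq_zero hmn ?_ i j)
  intro π hπ
  have he : ∀ π' : Equiv.Perm (Fin m),
      (Fin.castLE hmn ∘ π : Fin m → Fin n) = Fin.castLE hmn ∘ π' ↔ π' = π := by
    intro π'
    constructor
    · intro h
      ext t
      have := congrFun h t
      simp only [Function.comp_apply, Fin.castLE_inj] at this
      rw [this]
    · rintro rfl
      rfl
  simp only [he, ite_mul, one_mul, zero_mul, Finset.sum_ite_eq', Finset.mem_filter,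
    Finset.mem_univ, true_and, if_pos hπ, sub_self]

end BlockInvariant

/-! ### Cumulants of products -/

lemma pairwise_lt_filter_finRange (l : ℕ) (q : Fin l → Bool) :
    ((List.finRange l).filter q).Pairwise (· < ·) := by
  refine List.Pairwise.filter _ ?_
  rw [← List.ofFn_id, List.pairwise_ofFn]
  exact fun _ _ h => h

lemma ordProd_preimage [Monoid A] {l m : ℕ} {β : Fin m → Fin l} (hβ : Monotone β)
    (a : Fin m → A) (B : Set (Fin l)) :
    ordProd (fun j => ordProd a (β ⁻¹' {j})) B = ordProd a (β ⁻¹' B) := by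
  have h : (List.finRange m).filter (fun t => decide (t ∈ β ⁻¹' B))
      = ((List.finRange l).filter (fun j => decide (j ∈ B))).flatMap
        (fun j => (List.finRange m).filter (fun t => decide (t ∈ β ⁻¹' {j}))) := by
    refine List.Pairwise.eq_of_mem_iff (r := (· < ·)) (pairwise_lt_filter_finRange _ _) ?_ ?_
    · rw [List.pairwise_flatMap]
      refine ⟨fun j _ => pairwise_lt_filter_finRange _ _,
        (pairwise_lt_filter_finRange _ _).imp ?_⟩
      intro j j' hj x hx y hy
      simp only [List.mem_filter, List.mem_finRange, true_and, decide_eq_true_eq,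
        Set.mem_preimage, Set.mem_singleton_iff] at hx hy
      by_contra hxy
      exact absurd (hβ (not_lt.1 hxy)) (by rw [hx, hy]; exact not_le.2 hj)
    · intro x
      simp
  unfold ordProd
  rw [h]
  simp [List.flatMap, List.prod_flatten, List.map_flatten, List.map_map, Function.comp_def]

lemma momentV_comap {R : Type*} [CommRing R] [Monoid A] (E : A → R) {l m : ℕ}
    {β : Fin m → Fin l} (hβ : Monotone β) (hs : Function.Surjective β) (a : Fin m → A)
    (W : Setoid (Fin l)) :
    momentV E W (fun j => ordProd a (β ⁻¹' {j})) = momentV E (W.comap β) a := by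
  rw [momentV_eq_prod_quotient, momentV_eq_prod_quotient]
  symm
  refine Fintype.prod_bijective (Quotient.map β (fun _ _ h => h)) ⟨?_, ?_⟩ _ _ ?_
  · intro q q'
    induction q, q' using Quotient.inductionOn₂ with
    | h x y =>
      intro h
      exact Quotient.sound (s := W.comap β) (Quotient.eq (r := W).1 h)
  · intro q
    induction q using Quotient.inductionOn with
    | h y =>
      obtain ⟨x, rfl⟩ := hs y
      exact ⟨Quotient.mk _ x, rfl⟩
  · intro q
    induction q using Quotient.inductionOn with
    | h y =>
      rw [ordProd_preimage hβ]
      congr 2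
      ext x
      simp only [Set.mem_ofPred_eq, Set.mem_preimage]
      rw [Quotient.eq (r := W.comap β), Quotient.map_mk, Quotient.eq (r := W), Setoid.comap_rel]

/-- The cumulants of products over consecutive intervals (Leonov–Shiryaev formula). -/
lemma cumulant_ordProd [Monoid A] (E : A → ℂ)
    {k : ∀ {l : ℕ}, Setoid (Fin l) → (Fin l → A) → ℂ} (hk : IsCumulant E @k)
    {l m : ℕ} {β : Fin m → Fin l} (hβ : Monotone β) (hs : Function.Surjective β)
    (a : Fin m → A) (W : Setoid (Fin l)) :
    k W (fun j => ordProd a (β ⁻¹' {j}))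
      = ∑ V : Setoid (Fin m), if V ⊔ Setoid.ker β = W.comap β then k V a else 0 := by
  refine eq_of_sum_le_eq (f := fun W => k W (fun j => ordProd a (β ⁻¹' {j})))
    (g := fun W => ∑ V : Setoid (Fin m), if V ⊔ Setoid.ker β = W.comap β then k V a else 0) W
    fun u _ => ?_
  rw [hk, momentV_comap E hβ hs, ← hk, Finset.sum_comm, Finset.sum_filter]
  refine Finset.sum_congr rfl fun V _ => ?_
  have hmap : (Setoid.map (V ⊔ Setoid.ker β) β).comap β = V ⊔ Setoid.ker β :=
    Setoid.comap_map_of_ker_le β _ le_sup_right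
  have hker : ∀ w : Setoid (Fin l), Setoid.ker β ≤ w.comap β := by
    intro w x y h
    rw [Setoid.comap_rel, Setoid.ker_def.1 h]
  have hiff : ∀ w : Setoid (Fin l), V ⊔ Setoid.ker β = w.comap β
      ↔ w = Setoid.map (V ⊔ Setoid.ker β) β := by
    intro w
    rw [← (Setoid.comap_injective β hs).eq_iff, hmap, eq_comm]
  simp only [hiff, Finset.sum_ite_eq', Finset.mem_filter, Finset.mem_univ, true_and]
  refine if_congr ?_ rfl rfl
  have hmono : ∀ w w' : Setoid (Fin l), w.comap β ≤ w'.comap β ↔ w ≤ w' := by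
    intro w w'
    constructor
    · intro h x y hxy
      obtain ⟨x, rfl⟩ := hs x
      obtain ⟨y, rfl⟩ := hs y
      exact h hxy
    · intro h x y hxy
      exact h hxy
  rw [← hmono, hmap, sup_le_iff, and_iff_left (hker u)]

/-! ### Traces of powers -/

lemma pow_succ_apply [Ring A] {n : ℕ} (X : Matrix (Fin n) (Fin n) A) (q : ℕ) (x y : Fin n) :
    (X ^ (q + 1)) x y = ∑ f : Fin q → Fin n,
      (List.ofFn fun s : Fin (q + 1) => X ((Fin.cons x f : Fin (q + 1) → Fin n) s)
        ((Fin.snoc f y : Fin (q + 1) → Fin n) s)).prod := by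
  induction q generalizing x with
  | zero => simp [Fin.snoc]
  | succ q ih =>
    rw [pow_succ', Matrix.mul_apply, ← (Fin.consEquiv fun _ => Fin n).sum_comp,
      Fintype.sum_prod_type]
    refine Finset.sum_congr rfl fun c _ => ?_
    rw [ih, Finset.mul_sum]
    refine Finset.sum_congr rfl fun f _ => ?_
    rw [List.ofFn_succ (n := q + 1), List.prod_cons]
    change _ = X x ((Fin.snoc (Fin.cons c f : Fin (q + 1) → Fin n) y : Fin (q + 2) → Fin n) 0) *
      (List.ofFn fun s : Fin (q + 1) => X ((Fin.cons c f : Fin (q + 1) → Fin n) s)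
        ((Fin.snoc (Fin.cons c f : Fin (q + 1) → Fin n) y : Fin (q + 2) → Fin n) s.succ)).prod
    simp only [← Fin.cons_snoc_eq_snoc_cons, Fin.cons_zero, Fin.cons_succ]

lemma trace_pow [Ring A] {n : ℕ} (X : Matrix (Fin n) (Fin n) A) {q : ℕ} (hq : 1 ≤ q) :
    Matrix.trace (X ^ q) = ∑ f : Fin q → Fin n,
      (List.ofFn fun s : Fin q => X (f s) (f (finRotate q s))).prod := by
  obtain ⟨q, rfl⟩ := Nat.exists_eq_add_of_le' hq
  rw [← (Fin.consEquiv fun _ => Fin n).sum_comp, Fintype.sum_prod_type, Matrix.trace]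
  refine Finset.sum_congr rfl fun c _ => ?_
  rw [Matrix.diag_apply, pow_succ_apply]
  refine Finset.sum_congr rfl fun f _ => ?_
  rw [Fin.snoc_eq_cons_rotate]
  rfl

/-! ### The interval permutation -/

lemma eq_of_sameCycle {m : ℕ} {α : Type*} {σ : Equiv.Perm (Fin m)} {f : Fin m → α}
    (hf : ∀ t, f (σ t) = f t) {x y : Fin m} (h : σ.SameCycle x y) : f x = f y := by
  obtain ⟨q, -, rfl⟩ := h.exists_pow_eq'
  clear h
  induction q with
  | zero => rfl
  | succ q ih => rw [pow_succ', Equiv.Perm.mul_apply, hf, ih]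

lemma psum_succ {l : ℕ} (p : Fin l → ℕ) (j : Fin l) :
    psum p ((j : ℕ) + 1) = psum p j + p j := by
  have h : ∀ i : Fin l, (if (i : ℕ) < (j : ℕ) + 1 then p i else 0)
      = (if (i : ℕ) < (j : ℕ) then p i else 0) + if i = j then p i else 0 := by
    intro i
    by_cases h1 : i = j
    · subst h1
      simp
    · have : (i : ℕ) ≠ j := fun h => h1 (Fin.ext h)
      simp only [h1, if_false, add_zero]
      exact if_congr (by omega) rfl rfl
  simp only [psum, h, Finset.sum_add_distrib, Finset.sum_ite_eq', Finset.mem_univ, if_true]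

lemma psum_mono {l : ℕ} (p : Fin l → ℕ) : Monotone (psum p) := by
  intro x y h
  refine Finset.sum_le_sum fun i _ => ?_
  split_ifs <;> omega

lemma psum_add_lt {l : ℕ} (p : Fin l → ℕ) {j j' : Fin l} (h : j < j') (s : Fin (p j)) :
    psum p j + s < psum p j' := by
  have h1 := psum_mono p (Nat.succ_le_of_lt (Fin.lt_def.1 h))
  have h2 := psum_succ p j
  have h3 := s.2
  simp only [Nat.succ_eq_add_one] at h1
  omega

/-- The elements of `{1,…,psum p l}`, listed interval by interval. -/
def intervalEquiv {l : ℕ} (p : Fin l → ℕ) : (Σ j : Fin l, Fin (p j)) ≃ Fin (psum p l) :=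
  Equiv.ofBijective
    (fun x => ⟨psum p x.1 + x.2, by
      have h1 := psum_mono p (Nat.succ_le_of_lt x.1.2)
      have h2 := psum_succ p x.1
      have h3 := x.2.2
      simp only [Nat.succ_eq_add_one] at h1
      omega⟩) <| by
    rw [Fintype.bijective_iff_injective_and_card]
    constructor
    · rintro ⟨j, s⟩ ⟨j', s'⟩ h
      simp only [Fin.mk.injEq] at h
      rcases lt_trichotomy j j' with hj | hj | hj
      · have := psum_add_lt p hj s
        omega
      · subst hj
        simp only [Nat.add_left_cancel_iff] at h
        rw [Fin.ext h]
      · have := psum_add_lt p hj s'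
        omega
    · simp [psum]

lemma intervalEquiv_val {l : ℕ} (p : Fin l → ℕ) (j : Fin l) (s : Fin (p j)) :
    (intervalEquiv p ⟨j, s⟩ : ℕ) = psum p j + s := rfl

/-- The index of the interval containing a given element. -/
def intervalIndex {l : ℕ} (p : Fin l → ℕ) (t : Fin (psum p l)) : Fin l :=
  ((intervalEquiv p).symm t).1

lemma intervalIndex_apply {l : ℕ} (p : Fin l → ℕ) (j : Fin l) (s : Fin (p j)) :
    intervalIndex p (intervalEquiv p ⟨j, s⟩) = j := by
  simp [intervalIndex]

lemma intervalIndex_mono {l : ℕ} (p : Fin l → ℕ) : Monotone (intervalIndex p) := by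
  intro x y h
  obtain ⟨⟨j, s⟩, rfl⟩ := (intervalEquiv p).surjective x
  obtain ⟨⟨j', s'⟩, rfl⟩ := (intervalEquiv p).surjective y
  rw [intervalIndex_apply, intervalIndex_apply]
  by_contra hj
  have h1 := psum_add_lt p (not_le.1 hj) s'
  rw [Fin.le_def, intervalEquiv_val, intervalEquiv_val] at h
  omega

lemma intervalIndex_surjective {l : ℕ} {p : Fin l → ℕ} (hp : ∀ i, 1 ≤ p i) :
    Function.Surjective (intervalIndex p) :=
  fun j => ⟨intervalEquiv p ⟨j, ⟨0, hp j⟩⟩, intervalIndex_apply p j _⟩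

lemma ordProd_intervalIndex [Monoid A] {l : ℕ} (p : Fin l → ℕ) (a : Fin (psum p l) → A)
    (j : Fin l) :
    ordProd a (intervalIndex p ⁻¹' {j})
      = (List.ofFn fun s : Fin (p j) => a (intervalEquiv p ⟨j, s⟩)).prod := by
  have h : (List.finRange (psum p l)).filter (fun t => decide (t ∈ intervalIndex p ⁻¹' {j}))
      = List.ofFn fun s : Fin (p j) => intervalEquiv p ⟨j, s⟩ := by
    refine List.Pairwise.eq_of_mem_iff (r := (· < ·)) (pairwise_lt_filter_finRange _ _) ?_ ?_
    · rw [List.pairwise_ofFn]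
      intro s s' hs
      rw [Fin.lt_def, intervalEquiv_val, intervalEquiv_val]
      exact Nat.add_lt_add_left hs _
    · intro t
      obtain ⟨⟨j', s⟩, rfl⟩ := (intervalEquiv p).surjective t
      simp only [List.mem_filter, List.mem_finRange, true_and, decide_eq_true_eq,
        Set.mem_preimage, Set.mem_singleton_iff, intervalIndex_apply, List.mem_ofFn',
        Set.mem_range, EmbeddingLike.apply_eq_iff_eq]
      constructor
      · rintro rfl
        exact ⟨s, rfl⟩
      · rintro ⟨s', h⟩
        exact (congrArg Sigma.fst h).symm
  rw [ordProd, h, List.map_ofFn]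
  rfl

section CycleType

variable {l : ℕ} {p : Fin l → ℕ} {γ : Equiv.Perm (Fin (psum p l))}

lemma IsCycleType.apply_intervalEquiv (hγ : IsCycleType p γ) (j : Fin l) (s : Fin (p j)) :
    γ (intervalEquiv p ⟨j, s⟩) = intervalEquiv p ⟨j, finRotate (p j) s⟩ := by
  have hsucc := psum_succ p j
  have hs := s.2
  obtain ⟨q, hq⟩ := Nat.exists_eq_add_of_le' (Nat.one_le_of_lt hs)
  have hrot : (finRotate (p j) s : ℕ) = if (s : ℕ) + 1 = p j then 0 else (s : ℕ) + 1 := by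
    generalize p j = r at s hq
    subst hq
    rw [coe_finRotate]
    refine if_congr ?_ rfl rfl
    rw [Fin.ext_iff, Fin.val_last]
    omega
  ext
  rw [intervalEquiv_val, hrot]
  split_ifs with h
  · rw [hγ.2.2 j j.2 _ (by rw [intervalEquiv_val]; omega), add_zero]
  · rw [hγ.2.1 j j.2 _ (by rw [intervalEquiv_val]; omega) (by rw [intervalEquiv_val]; omega),
      intervalEquiv_val]
    omega

lemma IsCycleType.cycleSetoid_eq (hγ : IsCycleType p γ) :
    cycleSetoid γ = Setoid.ker (intervalIndex p) := by
  have hidx : ∀ t, intervalIndex p (γ t) = intervalIndex p t := by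
    intro t
    obtain ⟨⟨j, s⟩, rfl⟩ := (intervalEquiv p).surjective t
    rw [hγ.apply_intervalEquiv, intervalIndex_apply, intervalIndex_apply]
  have hzero : ∀ (j : Fin l) (s : ℕ) (hs : s < p j),
      γ.SameCycle (intervalEquiv p ⟨j, ⟨0, by omega⟩⟩) (intervalEquiv p ⟨j, ⟨s, hs⟩⟩) := by
    intro j s
    induction s with
    | zero => exact fun hs => Equiv.Perm.SameCycle.refl _ _
    | succ s ih =>
      intro hs
      have h := ih (by omega)
      have he : intervalEquiv p ⟨j, ⟨s + 1, hs⟩⟩ = γ (intervalEquiv p ⟨j, ⟨s, by omega⟩⟩) := by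
        have hsucc := psum_succ p j
        ext
        rw [hγ.2.1 j j.2 _ (by rw [intervalEquiv_val]; exact Nat.le_add_right _ _)
          (by rw [intervalEquiv_val, hsucc]; simp only; omega), intervalEquiv_val,
          intervalEquiv_val]
        rfl
      rw [he]
      exact Equiv.Perm.sameCycle_apply_right.2 h
  ext x y
  rw [Setoid.ker_def]
  constructor
  · exact eq_of_sameCycle hidx
  · obtain ⟨⟨j, s⟩, rfl⟩ := (intervalEquiv p).surjective x
    obtain ⟨⟨j', s'⟩, rfl⟩ := (intervalEquiv p).surjective y
    rw [intervalIndex_apply, intervalIndex_apply]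
    rintro rfl
    exact (hzero j s s.2).symm.trans (hzero j s' s'.2)

lemma IsCycleType.ordProd_eq [Monoid A] (hγ : IsCycleType p γ) {n : ℕ}
    (X : Matrix (Fin n) (Fin n) A) (i : Fin (psum p l) → Fin n) (j : Fin l) :
    ordProd (fun t => X (i t) (i (γ t))) (intervalIndex p ⁻¹' {j})
      = (List.ofFn fun s : Fin (p j) => X (i (intervalEquiv p ⟨j, s⟩))
        (i (intervalEquiv p ⟨j, finRotate (p j) s⟩))).prod := by
  rw [ordProd_intervalIndex]
  simp only [hγ.apply_intervalEquiv]

end CycleType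

/-! ### Counting functions which are constant on cycles -/

lemma card_comp_perm_eq {n m : ℕ} (σ : Equiv.Perm (Fin m)) :
    (Finset.univ.filter (fun i : Fin m → Fin n => ∀ t, i (σ t) = i t)).card
      = n ^ numCycles σ := by
  have hq : Fintype.card (Quotient (cycleSetoid σ)) = numCycles σ := by
    rw [numCycles, numBlocks, ← Nat.card_coe_set_eq,
      ← Nat.card_congr (Setoid.quotientEquivClasses (cycleSetoid σ)), Nat.card_eq_fintype_card]
  rw [← hq, ← Fintype.card_fin n, ← Fintype.card_fun, Fintype.card_fin, ← Finset.card_univ]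
  symm
  refine Finset.card_bij (fun f _ t => f (Quotient.mk (cycleSetoid σ) t)) ?_ ?_ ?_
  · intro f _
    simp only [Finset.mem_filter, Finset.mem_univ, true_and]
    intro t
    congr 1
    exact Quotient.sound (s := cycleSetoid σ)
      (Equiv.Perm.sameCycle_apply_left.2 (Equiv.Perm.SameCycle.refl σ t))
  · intro f _ g _ h
    ext q
    induction q using Quotient.inductionOn with
    | h t => exact congrArg Fin.val (congrFun h t)
  · intro i hi
    simp only [Finset.mem_filter, Finset.mem_univ, true_and] at hi
    exact ⟨Quotient.lift i fun x y => eq_of_sameCycle hi, Finset.mem_univ _, rfl⟩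

lemma sum_comp_perm_eq {n m : ℕ} (γ π : Equiv.Perm (Fin m)) :
    ∑ i : Fin m → Fin n, (if i ∘ γ = i ∘ π then (1 : ℂ) else 0)
      = (n : ℂ) ^ numCycles (γ * π⁻¹) := by
  rw [← Nat.cast_pow, ← card_comp_perm_eq, Finset.sum_boole]
  congr 2
  refine Finset.filter_congr fun i _ => ?_
  simp only [funext_iff, Function.comp_apply, Equiv.Perm.mul_apply]
  constructor
  · intro h t
    simpa using h (π⁻¹ t)
  · intro h t
    simpa using h (π t)

open scoped ComplexOrder in
/-- Moment–cumulant relation between traces of powers of a unitarily invariant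
random matrix with noncommutative entries and the cumulants of its entries:
`k(Tr X^{p₁},…,Tr X^{p_l}) = Σ_{(V,π) : V ∨ C(γ) = 1} κ_{(V,π)} n^{#(γπ⁻¹)}`. -/
theorem cumulants_of_traces_unitarily_invariant
    {A : Type*} [Ring A] [Algebra ℂ A] [StarRing A]
    (E : A →ₗ[ℂ] ℂ) (hE1 : E 1 = 1) (hEpos : ∀ x : A, x ≠ 0 → 0 < E (star x * x))
    (k : ∀ {l : ℕ}, Setoid (Fin l) → (Fin l → A) → ℂ) (hk : IsCumulant (⇑E) @k)
    {n : ℕ} (X : Matrix (Fin n) (Fin n) A) (hX : UnitarilyInvariant (⇑E) X)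
    {l : ℕ} (hl : 1 ≤ l) (p : Fin l → ℕ) (hp : ∀ i, 1 ≤ p i)
    {kk : ℕ} (hkk : psum p l = kk) (hkn : kk ≤ n)
    (γ : Equiv.Perm (Fin kk)) (hγ : IsCycleType p γ) :
    k ⊤ (fun i : Fin l => Matrix.trace (X ^ (p i)))
      = ∑ V : Setoid (Fin kk), ∑ π : Equiv.Perm (Fin kk),
          if permLePartition π V ∧ V ⊔ cycleSetoid γ = ⊤ then
            kappa @k X hkn V π * (n : ℂ) ^ (numCycles (γ * π⁻¹)) else 0 := by
  subst hkk
  obtain ⟨M, hM⟩ := exists_multilinearMap_eq_cumulant E hk (⊤ : Setoid (Fin l))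
  have htrace : k ⊤ (fun i : Fin l => Matrix.trace (X ^ (p i)))
      = ∑ i : Fin (psum p l) → Fin n,
        k ⊤ (fun j => ordProd (fun t => X (i t) (i (γ t))) (intervalIndex p ⁻¹' {j})) := by
    simp only [trace_pow X (hp _), hγ.ordProd_eq, ← hM]
    rw [MultilinearMap.map_sum]
    symm
    exact Fintype.sum_equiv (((intervalEquiv p).arrowCongr (Equiv.refl (Fin n))).symm.trans
      (Equiv.piCurry fun _ _ => Fin n)) _ _ fun i => rfl
  have htop : (⊤ : Setoid (Fin l)).comap (intervalIndex p) = ⊤ := rfl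
  rw [htrace]
  simp only [cumulant_ordProd (⇑E) hk (intervalIndex_mono p) (intervalIndex_surjective hp), htop,
    ← hγ.cycleSetoid_eq]
  rw [Finset.sum_comm]
  refine Finset.sum_congr rfl fun V _ => ?_
  by_cases hV : V ⊔ cycleSetoid γ = ⊤
  · simp only [hV, if_true, and_true]
    rw [← Finset.sum_filter]
    have h := fun i : Fin (psum p l) → Fin n =>
      (blockInvariant_cumulant E hk hX V).eq_sum_perm hkn i (i ∘ γ)
    simp only [Function.comp_apply] at h
    simp only [h]
    rw [Finset.sum_comm]
    refine Finset.sum_congr rfl fun π _ => ?_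
    rw [← Finset.sum_mul, sum_comp_perm_eq, mul_comm]
    rfl
  · simp [hV]

end HOF
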